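/- For every k ≥ 2, the k-localization number satisfies 𝔏_k ≤ 𝔳^g_k, i.e., the smallest cardinality of a family of k-branching trees covering {0,…,k}^ℕ is at most the smallest cardinality of a set of k globally adaptive predictors predicting all of ℕ^ℕ. -/

import Mathlib

/-- A tree: a set of finite sequences of naturals closed under initial segments. -/
def IsTree (T : Set (List ℕ)) : Prop :=
  ∀ σ ∈ T, ∀ n : ℕ, σ.take n ∈ T

/-- The immediate successors of a node `σ` within `T`. -/
def succs (T : Set (List ℕ)) (σ : List ℕ) : Set ℕ :=
  {m : ℕ | σ ++ [m] ∈ T}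

/-- A `k`-tree: a tree in which every node has at least `1` and at most `k`
immediate successors. -/
def IsKTree (k : ℕ) (T : Set (List ℕ)) : Prop :=
  IsTree T ∧ ∀ σ ∈ T, 1 ≤ (succs T σ).encard ∧ (succs T σ).encard ≤ k

/-- The initial segment `f↾n = ⟨f 0, …, f (n-1)⟩`. -/
def seg (f : ℕ → ℕ) (n : ℕ) : List ℕ :=
  List.ofFn fun i : Fin n => f i

/-- `f` is a branch of `T` if all its finite initial segments belong to `T`. -/
def IsBranch (T : Set (List ℕ)) (f : ℕ → ℕ) : Prop :=
  ∀ n : ℕ, seg f n ∈ T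

/-- A `k` globally adaptive predictor: a sequence `⟨π_n : n ∈ ℕ⟩` of functions,
where `π_n` assigns to each sequence `s ∈ ℕ^n` a `k`-element set of naturals. -/
structure Predictor (k : ℕ) where
  π : (n : ℕ) → (Fin n → ℕ) → Finset ℕ
  card_π : ∀ n s, (π n s).card = k

/-- `f` is predicted by `p` if from some point on, `f n ∈ π_n (f↾n)`. -/
def Predicts {k : ℕ} (p : Predictor k) (f : ℕ → ℕ) : Prop :=
  ∃ m : ℕ, ∀ n : ℕ, m < n → f n ∈ p.π n fun i : Fin n => f i

/-- A `k`-branching tree: a tree in which every node has either exactly `1` or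
exactly `k` immediate successors. -/
def IsKBranching (k : ℕ) (T : Set (List ℕ)) : Prop :=
  IsTree T ∧ ∀ σ ∈ T, (succs T σ).encard = 1 ∨ (succs T σ).encard = k

/-- The prediction number `𝔳^g_k`: the smallest cardinality of a set of `k`
globally adaptive predictors predicting every `f : ℕ → ℕ`. -/
noncomputable def predNum (k : ℕ) : Cardinal :=
  sInf {c : Cardinal | ∃ P : Set (Predictor k), Cardinal.mk P = c ∧
    ∀ f : ℕ → ℕ, ∃ p ∈ P, Predicts p f}

/-- The `k`-localization number `𝔏_k`: the smallest cardinality of a family of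
`k`-branching trees such that every `f : ℕ → {0,…,k}` is a branch of one of them. -/
noncomputable def locNum (k : ℕ) : Cardinal :=
  sInf {c : Cardinal | ∃ 𝒯 : Set (Set (List ℕ)), Cardinal.mk 𝒯 = c ∧
    (∀ T ∈ 𝒯, IsKBranching k T) ∧
    ∀ f : ℕ → ℕ, (∀ n, f n ≤ k) → ∃ T ∈ 𝒯, IsBranch T f}

/-- The tree of all finite sequences each of whose entries lies in the set that `q` assigns
to the preceding entries. -/
def guidedTree (q : List ℕ → Set ℕ) : Set (List ℕ) :=
  {t | ∀ (u : List ℕ) (x : ℕ), u ++ [x] <+: t → x ∈ q u}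

theorem isTree_guidedTree (q : List ℕ → Set ℕ) : IsTree (guidedTree q) :=
  fun σ hσ n u x h => hσ u x (h.trans (List.take_prefix n σ))

theorem concat_mem_guidedTree {q : List ℕ → Set ℕ} {σ : List ℕ} (hσ : σ ∈ guidedTree q) (m : ℕ) :
    σ ++ [m] ∈ guidedTree q ↔ m ∈ q σ := by
  refine ⟨fun h => h σ m (List.prefix_refl _), fun h u x hu => ?_⟩
  rcases List.prefix_concat_iff.1 hu with hu | hu
  · obtain ⟨rfl, hx⟩ := List.append_inj' hu rfl
    obtain rfl : x = m := by simpa using hx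
    exact h
  · exact hσ u x hu

theorem isKBranching_guidedTree {k : ℕ} {q : List ℕ → Set ℕ}
    (hq : ∀ σ, (q σ).encard = 1 ∨ (q σ).encard = k) : IsKBranching k (guidedTree q) := by
  refine ⟨isTree_guidedTree q, fun σ hσ => ?_⟩
  have : succs (guidedTree q) σ = q σ := Set.ext fun m => concat_mem_guidedTree hσ m
  rw [this]
  exact hq σ

theorem seg_succ (f : ℕ → ℕ) (n : ℕ) : seg f (n + 1) = seg f n ++ [f n] := by
  exact List.ofFn_succ_last

theorem isBranch_guidedTree {q : List ℕ → Set ℕ} {f : ℕ → ℕ} (hf : ∀ n, f n ∈ q (seg f n)) :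
    IsBranch (guidedTree q) f := by
  intro n
  induction n with
  | zero => intro u x h; simp [seg] at h
  | succ n ih =>
    rw [seg_succ]
    exact (concat_mem_guidedTree ih _).2 (hf n)

/-- Follow the sequence `s` as long as it lasts, and the predictor `p` afterwards. -/
def Predictor.guide {k : ℕ} (p : Predictor k) (s : List ℕ) (t : List ℕ) : Set ℕ :=
  if t.length < s.length then {s.getD t.length 0}
  else p.π t.length fun i : Fin t.length => t.getD i 0

theorem Predictor.encard_guide {k : ℕ} (p : Predictor k) (s t : List ℕ) :
    (p.guide s t).encard = 1 ∨ (p.guide s t).encard = k := by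
  unfold Predictor.guide
  split_ifs
  · simp
  · right
    rw [Set.encard_coe_eq_coe_finsetCard, p.card_π]

@[simp] theorem length_seg (f : ℕ → ℕ) (n : ℕ) : (seg f n).length = n := by
  simp [seg]

theorem getD_seg (f : ℕ → ℕ) {n i : ℕ} (h : i < n) : (seg f n).getD i 0 = f i := by
  simp [seg, h]

theorem Predicts.exists_isBranch {k : ℕ} {p : Predictor k} {f : ℕ → ℕ} (h : Predicts p f) :
    ∃ s, IsBranch (guidedTree (p.guide s)) f := by
  obtain ⟨m, hm⟩ := h
  refine ⟨seg f (m + 1), isBranch_guidedTree fun n => ?_⟩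
  unfold Predictor.guide
  split_ifs with hn
  · rw [length_seg, length_seg] at hn
    rw [length_seg, getD_seg f hn]
    rfl
  · rw [length_seg, length_seg] at hn
    have hseg : (fun i : Fin (seg f n).length => (seg f n).getD i 0) =
        fun i : Fin (seg f n).length => f i :=
      funext fun i => getD_seg f (by simpa using i.2)
    rw [hseg, length_seg]
    exact hm n (by omega)

theorem exists_predicts {k : ℕ} (hk : 0 < k) (f : ℕ → ℕ) : ∃ p : Predictor k, Predicts p f :=
  ⟨⟨fun n _ => (Finset.range k).map (addLeftEmbedding (f n)), by simp⟩, 0, fun n _ => by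
    simpa using hk⟩

/-- Finitely many predictors can be evaded simultaneously. -/
theorem exists_forall_not_predicts {k : ℕ} {P : Set (Predictor k)} (hP : P.Finite) :
    ∃ f : ℕ → ℕ, ∀ p ∈ P, ¬ Predicts p f := by
  have key : ∀ (n : ℕ) (s : Fin n → ℕ), ∃ x, ∀ p ∈ P, x ∉ p.π n s := by
    intro n s
    obtain ⟨x, hx⟩ := (hP.biUnion fun p _ => (p.π n s).finite_toSet).exists_notMem
    exact ⟨x, by simpa using hx⟩
  choose g hg using key
  let f : ℕ → ℕ := fun n => Nat.strongRec (fun n ih => g n fun i => ih i i.2) n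
  have hf : ∀ n, f n = g n fun i => f i := fun n => by
    simp only [f]
    rw [Nat.strongRec]
  refine ⟨f, fun p hp ⟨m, hm⟩ => hg (m + 1) (fun i => f i) p hp ?_⟩
  rw [← hf]
  exact hm (m + 1) (Nat.lt_succ_self m)

theorem stmt8 (k : ℕ) (hk : 2 ≤ k) : locNum k ≤ predNum k := by
  refine le_csInf ⟨_, Set.univ, rfl, fun f => ?_⟩ ?_
  · obtain ⟨p, hp⟩ := exists_predicts (by omega : 0 < k) f
    exact ⟨p, trivial, hp⟩
  rintro _ ⟨P, rfl, hP⟩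
  have hinf : P.Infinite := fun hfin => by
    obtain ⟨f, hf⟩ := exists_forall_not_predicts hfin
    obtain ⟨p, hp, hpf⟩ := hP f
    exact hf p hp hpf
  have : Infinite P := hinf.to_subtype
  let F : P × List ℕ → Set (List ℕ) := fun x => guidedTree (x.1.1.guide x.2)
  calc locNum k ≤ Cardinal.mk (Set.range F) := by
        refine csInf_le' ⟨Set.range F, rfl, ?_, fun f _ => ?_⟩
        · rintro _ ⟨x, rfl⟩
          exact isKBranching_guidedTree (x.1.1.encard_guide x.2)
        · obtain ⟨p, hp, hpf⟩ := hP f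
          obtain ⟨s, hs⟩ := hpf.exists_isBranch
          exact ⟨_, ⟨(⟨p, hp⟩, s), rfl⟩, hs⟩
    _ ≤ Cardinal.mk (P × List ℕ) := Cardinal.mk_range_le
    _ = Cardinal.mk P := by
        rw [Cardinal.mk_prod, Cardinal.lift_id, Cardinal.lift_id, Cardinal.mk_eq_aleph0 (List ℕ)]
        exact Cardinal.mul_aleph0_eq (Cardinal.aleph0_le_mk P)
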